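/- Let G be a graph containing no jewel or pyramid, let C be a shortest odd hole in G, and let X be a stable set of C-major vertices. Then some vertex of C is X-complete. -/

import Mathlib

/-!
Common definitions: holes, odd holes, C-major vertices, induced paths,
pyramids, jewels, candidates, x-gaps, gaps and normal sets.
A hole of length `n` is encoded as an injective map `f : ZMod n → V`
such that adjacency in `G` between vertices of the hole holds exactly
for consecutive indices (i.e. the hole is an induced cycle).
-/

variable {V : Type*}

/-- A hole: an induced cycle of length `n ≥ 4`. -/
def IsHole (G : SimpleGraph V) (n : ℕ) (f : ZMod n → V) : Prop :=
  4 ≤ n ∧ Function.Injective f ∧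
    ∀ i j : ZMod n, G.Adj (f i) (f j) ↔ (j = i + 1 ∨ i = j + 1)

/-- An odd hole. -/
def IsOddHole (G : SimpleGraph V) (n : ℕ) (f : ZMod n → V) : Prop :=
  IsHole G n f ∧ Odd n

/-- A shortest odd hole: an odd hole of minimum length among all odd holes. -/
def IsShortestOddHole (G : SimpleGraph V) (n : ℕ) (f : ZMod n → V) : Prop :=
  IsOddHole G n f ∧ ∀ (m : ℕ) (g : ZMod m → V), IsOddHole G m g → n ≤ m

/-- `G` has an odd hole. -/
def HasOddHole (G : SimpleGraph V) : Prop :=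
  ∃ (n : ℕ) (f : ZMod n → V), IsOddHole G n f

/-- A vertex `v` is `C`-major (for the hole given by `f`): `v` is not on the hole and
no three consecutive vertices of the hole contain all neighbours of `v` on the hole. -/
def IsCMajor (G : SimpleGraph V) {n : ℕ} (f : ZMod n → V) (v : V) : Prop :=
  v ∉ Set.range f ∧
    ∀ i : ZMod n, ∃ j : ZMod n, G.Adj v (f j) ∧ j ≠ i - 1 ∧ j ≠ i ∧ j ≠ i + 1

/-- An induced path of length `k`, encoded by its sequence of vertices:
adjacency holds exactly between consecutive vertices. -/
def IsInducedPathMap (G : SimpleGraph V) (k : ℕ) (p : Fin (k + 1) → V) : Prop :=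
  Function.Injective p ∧
    ∀ i j : Fin (k + 1), G.Adj (p i) (p j) ↔ (i.val + 1 = j.val ∨ j.val + 1 = i.val)

/-- A (not necessarily induced) path of length `k`, encoded by its sequence of vertices. -/
def IsPathMap (G : SimpleGraph V) (k : ℕ) (p : Fin (k + 1) → V) : Prop :=
  Function.Injective p ∧ ∀ i : Fin k, G.Adj (p i.castSucc) (p i.succ)

/-- A pyramid with apex `v0`, base `{v1, v2, v3}`, and paths `p1, p2, p3`
(of lengths `k1, k2, k3`) from `v0` to `v1, v2, v3` respectively. -/
def IsPyramid (G : SimpleGraph V) (v0 v1 v2 v3 : V) (k1 k2 k3 : ℕ)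
    (p1 : Fin (k1 + 1) → V) (p2 : Fin (k2 + 1) → V) (p3 : Fin (k3 + 1) → V) : Prop :=
  IsInducedPathMap G k1 p1 ∧ IsInducedPathMap G k2 p2 ∧ IsInducedPathMap G k3 p3 ∧
  p1 0 = v0 ∧ p2 0 = v0 ∧ p3 0 = v0 ∧
  p1 (Fin.last k1) = v1 ∧ p2 (Fin.last k2) = v2 ∧ p3 (Fin.last k3) = v3 ∧
  v1 ≠ v0 ∧ v2 ≠ v0 ∧ v3 ≠ v0 ∧
  G.Adj v1 v2 ∧ G.Adj v1 v3 ∧ G.Adj v2 v3 ∧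
  ((2 ≤ k1 ∧ 2 ≤ k2) ∨ (2 ≤ k1 ∧ 2 ≤ k3) ∨ (2 ≤ k2 ∧ 2 ≤ k3)) ∧
  (Set.range p1 ∩ Set.range p2 ⊆ {v0}) ∧
  (Set.range p1 ∩ Set.range p3 ⊆ {v0}) ∧
  (Set.range p2 ∩ Set.range p3 ⊆ {v0}) ∧
  (∀ u w : V, u ∈ Set.range p1 → w ∈ Set.range p2 → u ≠ v0 → w ≠ v0 →
    G.Adj u w → u = v1 ∧ w = v2) ∧
  (∀ u w : V, u ∈ Set.range p1 → w ∈ Set.range p3 → u ≠ v0 → w ≠ v0 →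
    G.Adj u w → u = v1 ∧ w = v3) ∧
  (∀ u w : V, u ∈ Set.range p2 → w ∈ Set.range p3 → u ≠ v0 → w ≠ v0 →
    G.Adj u w → u = v2 ∧ w = v3)

/-- `G` contains a pyramid. -/
def ContainsPyramid (G : SimpleGraph V) : Prop :=
  ∃ (v0 v1 v2 v3 : V) (k1 k2 k3 : ℕ) (p1 : Fin (k1 + 1) → V)
    (p2 : Fin (k2 + 1) → V) (p3 : Fin (k3 + 1) → V),
    IsPyramid G v0 v1 v2 v3 k1 k2 k3 p1 p2 p3

/-- A jewel on vertices `v1, …, v5` together with the path `p` (of length `k`)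
from `v1` to `v4`. -/
def IsJewel (G : SimpleGraph V) (v1 v2 v3 v4 v5 : V) (k : ℕ)
    (p : Fin (k + 1) → V) : Prop :=
  List.Pairwise Ne [v1, v2, v3, v4, v5] ∧
  G.Adj v1 v2 ∧ G.Adj v2 v3 ∧ G.Adj v3 v4 ∧ G.Adj v4 v5 ∧ G.Adj v5 v1 ∧
  ¬ G.Adj v1 v3 ∧ ¬ G.Adj v2 v4 ∧ ¬ G.Adj v1 v4 ∧
  IsInducedPathMap G k p ∧ p 0 = v1 ∧ p (Fin.last k) = v4 ∧
  ∀ i : Fin (k + 1), i ≠ 0 → i ≠ Fin.last k →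
    ¬ G.Adj v2 (p i) ∧ ¬ G.Adj v3 (p i) ∧ ¬ G.Adj v5 (p i)

/-- `G` contains a jewel. -/
def ContainsJewel (G : SimpleGraph V) : Prop :=
  ∃ (v1 v2 v3 v4 v5 : V) (k : ℕ) (p : Fin (k + 1) → V),
    IsJewel G v1 v2 v3 v4 v5 k p

/-- A candidate: a graph with no jewel, no pyramid, and no heavy-cleanable shortest
odd hole (a shortest odd hole is heavy-cleanable if some edge of it has the property
that every major vertex is adjacent to one of its ends). -/
def Candidate (G : SimpleGraph V) : Prop :=
  ¬ ContainsJewel G ∧ ¬ ContainsPyramid G ∧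
  ¬ ∃ (n : ℕ) (f : ZMod n → V) (i : ZMod n), IsShortestOddHole G n f ∧
      ∀ v : V, IsCMajor G f v → (G.Adj v (f i) ∨ G.Adj v (f (i + 1)))

/-- An `x`-gap of a hole `f : ZMod n → V`: an induced path of the hole, of length
`ℓ ≥ 2`, starting at index `a` and ending at index `a + ℓ`, whose ends are adjacent
to `x` and whose internal vertices are nonadjacent to `x`. (The condition `ℓ + 2 ≤ n`
says that the arc is an induced path of the hole.) -/
def IsXGap (G : SimpleGraph V) {n : ℕ} (f : ZMod n → V) (x : V) (a : ZMod n)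
    (ℓ : ℕ) : Prop :=
  2 ≤ ℓ ∧ ℓ + 2 ≤ n ∧ G.Adj x (f a) ∧ G.Adj x (f (a + (ℓ : ZMod n))) ∧
    ∀ t : ℕ, 0 < t → t < ℓ → ¬ G.Adj x (f (a + (t : ZMod n)))

/-- `ℓ` is the length of an `A`-gap of the cycle on `ZMod n` (with `A ⊆ ZMod n`):
either `A = ∅` and the gap is the whole cycle, or the gap runs from some `i ∈ A`
to `i + ℓ ∈ A` with no internal vertex in `A`. -/
def IsGapLength (n : ℕ) (A : Set (ZMod n)) (ℓ : ℕ) : Prop :=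
  (A = ∅ ∧ ℓ = n) ∨
  (2 ≤ ℓ ∧ ℓ ≤ n ∧ ∃ i ∈ A, (i + (ℓ : ZMod n)) ∈ A ∧
    ∀ t : ℕ, 0 < t → t < ℓ → (i + (t : ZMod n)) ∉ A)

/-- `A` is normal in the cycle on `ZMod n`: every `A`-gap has even length. -/
def NormalInCycle (n : ℕ) (A : Set (ZMod n)) : Prop :=
  ∀ ℓ : ℕ, IsGapLength n A ℓ → Even ℓ

section Sequences

variable {G : SimpleGraph V}

/-- The vertices `p 0, …, p k` form an induced path in this order. -/
def IsSeqPath (G : SimpleGraph V) (k : ℕ) (p : ℕ → V) : Prop :=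
  ∀ i j, i < j → j ≤ k → p i ≠ p j ∧ (G.Adj (p i) (p j) ↔ j = i + 1)

lemma IsSeqPath.adj_iff {k : ℕ} {p : ℕ → V} (h : IsSeqPath G k p) {i j : ℕ}
    (hi : i ≤ k) (hj : j ≤ k) : G.Adj (p i) (p j) ↔ (i + 1 = j ∨ j + 1 = i) := by
  rcases lt_trichotomy i j with hij | rfl | hij
  · rw [(h i j hij hj).2]; omega
  · simp
  · rw [G.adj_comm, (h j i hij hi).2]; omega

lemma IsSeqPath.inj {k : ℕ} {p : ℕ → V} (h : IsSeqPath G k p) {i j : ℕ}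
    (hi : i ≤ k) (hj : j ≤ k) (e : p i = p j) : i = j := by
  rcases lt_trichotomy i j with hij | rfl | hij
  · exact absurd e (h i j hij hj).1
  · rfl
  · exact absurd e.symm (h j i hij hi).1

lemma IsSeqPath.isInducedPathMap {k : ℕ} {p : ℕ → V} (h : IsSeqPath G k p) :
    IsInducedPathMap G k (fun i => p i.val) :=
  ⟨fun i j e => Fin.ext (h.inj (by omega) (by omega) e),
    fun i j => h.adj_iff (by omega) (by omega)⟩

lemma IsSeqPath.reverse {k : ℕ} {p : ℕ → V} (h : IsSeqPath G k p) :
    IsSeqPath G k (fun i => p (k - i)) := by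
  intro i j hij hj
  refine ⟨fun e => ?_, ?_⟩
  · have := h.inj (by omega) (by omega) e
    omega
  · rw [h.adj_iff (by omega) (by omega)]; omega

lemma isSeqPath_zero (p : ℕ → V) : IsSeqPath G 0 p := by
  intro i j hij hj; omega

/-- The concatenation of `p 0, …, p k` and `r 0, r 1, …`. -/
def seqAppend (k : ℕ) (p r : ℕ → V) : ℕ → V :=
  fun i => if i ≤ k then p i else r (i - k - 1)

lemma seqAppend_left {k : ℕ} {p r : ℕ → V} {i : ℕ} (h : i ≤ k) : seqAppend k p r i = p i :=
  if_pos h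

lemma seqAppend_right {k : ℕ} {p r : ℕ → V} (i : ℕ) :
    seqAppend k p r (k + 1 + i) = r i := by
  unfold seqAppend
  rw [if_neg (by omega)]
  congr 1
  omega

lemma IsSeqPath.append {k l : ℕ} {p r : ℕ → V} (hp : IsSeqPath G k p) (hr : IsSeqPath G l r)
    (hne : ∀ i j, i ≤ k → j ≤ l → p i ≠ r j)
    (hadj : ∀ i j, i ≤ k → j ≤ l → (G.Adj (p i) (r j) ↔ i = k ∧ j = 0)) :
    IsSeqPath G (k + 1 + l) (seqAppend k p r) := by
  intro i j hij hj
  rcases le_or_gt j k with hjk | hjk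
  · rw [seqAppend_left hjk, seqAppend_left (by omega)]
    exact hp i j hij hjk
  obtain ⟨j, rfl⟩ := Nat.exists_eq_add_of_le (show k + 1 ≤ j by omega)
  rw [seqAppend_right]
  rcases le_or_gt i k with hik | hik
  · rw [seqAppend_left hik]
    refine ⟨hne i j hik (by omega), ?_⟩
    rw [hadj i j hik (by omega)]; omega
  · obtain ⟨i, rfl⟩ := Nat.exists_eq_add_of_le (show k + 1 ≤ i by omega)
    rw [seqAppend_right]
    refine ⟨(hr i j (by omega) (by omega)).1, ?_⟩
    rw [(hr i j (by omega) (by omega)).2]; omega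

lemma IsSeqPath.cons {k : ℕ} {p : ℕ → V} (hp : IsSeqPath G k p) (x : V)
    (hne : ∀ i, i ≤ k → x ≠ p i) (hadj : ∀ i, i ≤ k → (G.Adj x (p i) ↔ i = 0)) :
    IsSeqPath G (k + 1) (seqAppend 0 (fun _ => x) p) := by
  have := (isSeqPath_zero (G := G) (fun _ => x)).append hp (fun _ j _ hj => hne j hj)
    (fun i j hi hj => by rw [hadj j hj]; omega)
  rwa [show 0 + 1 + k = k + 1 by omega] at this

lemma eq_or_exists_of_mem_range_cons {k : ℕ} {p : ℕ → V} {x w : V}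
    (h : w ∈ Set.range (fun j : Fin (k + 1 + 1) => seqAppend 0 (fun _ => x) p j.val)) :
    w = x ∨ ∃ i, i ≤ k ∧ w = p i := by
  obtain ⟨j, rfl⟩ := h
  rcases Nat.eq_zero_or_pos j.val with hj | hj
  · left; simp [hj, seqAppend]
  · right
    refine ⟨j.val - 1, by omega, ?_⟩
    simp only [seqAppend]
    rw [if_neg (by omega)]
    rfl

/-- A vertex adjacent to exactly the ends of an induced path closes it into a hole. -/
lemma IsSeqPath.exists_isHole {k : ℕ} {p : ℕ → V} (hp : IsSeqPath G k p) (hk : 2 ≤ k) (x : V)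
    (hne : ∀ i, i ≤ k → x ≠ p i) (hadj : ∀ i, i ≤ k → (G.Adj x (p i) ↔ i = 0 ∨ i = k)) :
    ∃ g : ZMod (k + 2) → V, IsHole G (k + 2) g := by
  have key : ∀ i j : ZMod (k + 2), (j = i + 1) ↔ (j.val = i.val + 1 ∨ (j.val = 0 ∧ i.val = k + 1)) := by
    intro i j
    have hi := i.val_lt
    have hj := j.val_lt
    rw [← (ZMod.val_injective (k + 2)).eq_iff, ZMod.val_add,
      ZMod.val_one'' (by omega)]
    rcases eq_or_ne i.val (k + 1) with h | h
    · rw [h, Nat.mod_self]; omega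
    · rw [Nat.mod_eq_of_lt (by omega)]; omega
  refine ⟨fun i => seqAppend k p (fun _ => x) i.val, by omega, ?_, ?_⟩
  · intro i j e
    apply ZMod.val_injective
    have hi := i.val_lt
    have hj := j.val_lt
    by_cases h1 : i.val ≤ k <;> by_cases h2 : j.val ≤ k <;> simp [seqAppend, h1, h2] at e
    · exact hp.inj h1 h2 e
    · exact absurd e.symm (hne _ h1)
    · exact absurd e (hne _ h2)
    · omega
  · intro i j
    have hi := i.val_lt
    have hj := j.val_lt
    rw [key i j, key j i]
    by_cases h1 : i.val ≤ k <;> by_cases h2 : j.val ≤ k <;> simp only [seqAppend, h1, h2, if_true, if_false]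
    · rw [hp.adj_iff h1 h2]; omega
    · rw [G.adj_comm, hadj _ h1]; omega
    · rw [hadj _ h2]; omega
    · simp only [SimpleGraph.irrefl, false_iff]; omega

end Sequences

section Holes

variable {G : SimpleGraph V} {n : ℕ} {f : ZMod n → V} {x y : V}

lemma natCast_zmod_eq_iff {i j : ℕ} (hi : i < n) (hj : j < n) :
    (i : ZMod n) = j ↔ i = j := by
  rw [ZMod.natCast_eq_natCast_iff', Nat.mod_eq_of_lt hi, Nat.mod_eq_of_lt hj]

lemma natCast_zmod_eq_succ_iff {i j : ℕ} (hi : i < n) (hj : j < n) :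
    (j : ZMod n) = i + 1 ↔ j = i + 1 ∨ (j = 0 ∧ i + 1 = n) := by
  have : (i : ZMod n) + 1 = ((i + 1 : ℕ) : ZMod n) := by push_cast; rfl
  rw [this]
  rcases eq_or_ne (i + 1) n with h | h
  · have h0 : ((i + 1 : ℕ) : ZMod n) = ((0 : ℕ) : ZMod n) := by rw [h]; simp
    rw [h0, natCast_zmod_eq_iff hj (by omega)]; omega
  · rw [natCast_zmod_eq_iff hj (by omega)]; omega

lemma IsHole.natCast_inj (h : IsHole G n f) {i j : ℕ} (hi : i < n) (hj : j < n)
    (e : f i = f j) : i = j :=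
  (natCast_zmod_eq_iff hi hj).1 (h.2.1 e)

lemma IsHole.natCast_adj_iff (h : IsHole G n f) {i j : ℕ} (hi : i < n) (hj : j < n) :
    G.Adj (f i) (f j) ↔
      (i + 1 = j ∨ j + 1 = i ∨ (i = 0 ∧ j + 1 = n) ∨ (j = 0 ∧ i + 1 = n)) := by
  rw [h.2.2, natCast_zmod_eq_succ_iff hi hj, natCast_zmod_eq_succ_iff hj hi]; omega

lemma exists_natCast_eq (hn : 4 ≤ n) (j : ZMod n) : ∃ i : ℕ, i < n ∧ (i : ZMod n) = j := by
  have : NeZero n := ⟨by omega⟩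
  exact ⟨j.val, j.val_lt, ZMod.natCast_zmod_val j⟩

lemma IsShortestOddHole.shift (h : IsShortestOddHole G n f) (c : ZMod n) :
    IsShortestOddHole G n (fun i => f (c + i)) := by
  obtain ⟨⟨⟨h4, hi, ha⟩, ho⟩, hmin⟩ := h
  refine ⟨⟨⟨h4, fun i j e => add_left_cancel (hi e), fun i j => ?_⟩, ho⟩, hmin⟩
  rw [ha, add_assoc, add_assoc, add_right_inj, add_right_inj]

lemma IsShortestOddHole.reflect (h : IsShortestOddHole G n f) (c : ZMod n) :
    IsShortestOddHole G n (fun i => f (c - i)) := by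
  obtain ⟨⟨⟨h4, hi, ha⟩, ho⟩, hmin⟩ := h
  refine ⟨⟨⟨h4, fun i j e => sub_right_injective (hi e), fun i j => ?_⟩, ho⟩, hmin⟩
  rw [ha]
  constructor
  · rintro (e | e)
    · right; linear_combination e
    · left; linear_combination e
  · rintro (e | e)
    · right; linear_combination e
    · left; linear_combination e

lemma IsCMajor.shift (h : IsCMajor G f x) (c : ZMod n) :
    IsCMajor G (fun i => f (c + i)) x := by
  refine ⟨fun ⟨i, e⟩ => h.1 ⟨_, e⟩, fun i => ?_⟩
  obtain ⟨j, h1, h2, h3, h4⟩ := h.2 (c + i)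
  refine ⟨j - c, by simpa using h1, fun e => h2 ?_, fun e => h3 ?_, fun e => h4 ?_⟩ <;>
    linear_combination e

lemma IsCMajor.reflect (h : IsCMajor G f x) (c : ZMod n) :
    IsCMajor G (fun i => f (c - i)) x := by
  refine ⟨fun ⟨i, e⟩ => h.1 ⟨_, e⟩, fun i => ?_⟩
  obtain ⟨j, h1, h2, h3, h4⟩ := h.2 (c - i)
  refine ⟨c - j, by simpa using h1, fun e => h4 ?_, fun e => h3 ?_, fun e => h2 ?_⟩ <;>
    linear_combination -e

lemma IsCMajor.ne (h : IsCMajor G f x) (i : ZMod n) : x ≠ f i := fun e => h.1 ⟨i, e.symm⟩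

/-- The neighbours of a major vertex are not confined to three consecutive positions. -/
lemma IsCMajor.exists_natCast (h : IsCMajor G f x) (hn : 4 ≤ n) (i : ZMod n) :
    ∃ k : ℕ, k < n ∧ G.Adj x (f k) ∧ (k : ZMod n) ≠ i - 1 ∧ (k : ZMod n) ≠ i ∧
      (k : ZMod n) ≠ i + 1 := by
  obtain ⟨j, hj⟩ := h.2 i
  obtain ⟨k, hk, rfl⟩ := exists_natCast_eq hn j
  exact ⟨k, hk, hj⟩

/-- A stretch of the hole not containing both position `0` and position `n - 1`. -/
lemma IsHole.isSeqPath (h : IsHole G n f) {s k : ℕ} (hs : s + k < n) (h0 : 0 < s ∨ s + k + 1 < n) :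
    IsSeqPath G k (fun i => f ((s + i : ℕ) : ZMod n)) := by
  intro i j hij hj
  refine ⟨fun e => ?_, ?_⟩
  · have := h.natCast_inj (by omega) (by omega) e
    omega
  · rw [h.natCast_adj_iff (by omega) (by omega)]; omega

lemma IsShortestOddHole.le_of_isSeqPath (h : IsShortestOddHole G n f) {k : ℕ} {p : ℕ → V}
    (hp : IsSeqPath G k p) (hk : 2 ≤ k) (hodd : Odd k) (x : V)
    (hne : ∀ i, i ≤ k → x ≠ p i) (hadj : ∀ i, i ≤ k → (G.Adj x (p i) ↔ i = 0 ∨ i = k)) :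
    n ≤ k + 2 := by
  obtain ⟨g, hg⟩ := hp.exists_isHole hk x hne hadj
  exact h.2 _ g ⟨hg, by rw [Nat.odd_iff] at *; omega⟩

lemma IsShortestOddHole.even_gap_zero (h : IsShortestOddHole G n f) (hx : IsCMajor G f x) {k : ℕ}
    (hk : 2 ≤ k) (hkn : k ≤ n) (h0 : G.Adj x (f 0)) (h1 : G.Adj x (f k))
    (hb : ∀ i : ℕ, 0 < i → i < k → ¬ G.Adj x (f i)) : Even k := by
  by_contra hodd
  rw [Nat.not_even_iff_odd] at hodd
  have h4 := h.1.1.1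
  have hk3 : k + 3 ≤ n := by
    by_contra hcon
    obtain ⟨j, hj, hadj, h2, h3, h5⟩ := hx.exists_natCast h4 (-1)
    have e0 : j ≠ 0 := by rintro rfl; simp at h5
    have e1 : j + 1 ≠ n := by
      rintro rfl
      apply h3
      have : ((j + 1 : ℕ) : ZMod (j + 1)) = 0 := ZMod.natCast_self _
      push_cast at this
      linear_combination this
    have e2 : j + 2 ≠ n := by
      rintro rfl
      apply h2
      have : ((j + 2 : ℕ) : ZMod (j + 2)) = 0 := ZMod.natCast_self _
      push_cast at this
      linear_combination this
    exact hb j (by omega) (by omega) hadj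
  have hp := h.1.1.isSeqPath (s := 0) (k := k) (by omega) (by omega)
  have := h.le_of_isSeqPath hp hk hodd x (fun i _ => hx.ne _) (by
    intro i hi
    rw [zero_add]
    refine ⟨fun ha => ?_, ?_⟩
    · by_contra hne
      exact hb i (by omega) (by omega) ha
    · rintro (rfl | rfl)
      · simpa using h0
      · exact h1)
  omega

/-- Two consecutive neighbours on a shortest odd hole of a major vertex are
adjacent or at even distance. -/
lemma IsShortestOddHole.even_gap (h : IsShortestOddHole G n f) (hx : IsCMajor G f x) {s t : ℕ}
    (hst : s + 2 ≤ t) (htn : t ≤ s + n) (hs : G.Adj x (f s)) (ht : G.Adj x (f t))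
    (hb : ∀ i : ℕ, s < i → i < t → ¬ G.Adj x (f i)) : Even (t - s) := by
  obtain ⟨k, rfl⟩ := Nat.exists_eq_add_of_le (show s ≤ t by omega)
  rw [Nat.add_sub_cancel_left]
  refine (h.shift s).even_gap_zero (hx.shift s) (by omega) (by omega) (by simpa using hs)
    (by simpa using ht) fun i hi hik ha => hb (s + i) (by omega) (by omega) (by simpa using ha)

lemma IsShortestOddHole.no_three_zero (h : IsShortestOddHole G n f) (hP : ¬ ContainsPyramid G)
    (hx : IsCMajor G f x) {i : ℕ} (hi : 2 ≤ i) (hin : i + 3 ≤ n)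
    (hA : ∀ j : ℕ, j < n → (G.Adj x (f j) ↔ j = 0 ∨ j = i ∨ j = i + 1)) : False := by
  have hh := h.1.1
  have h4 := hh.1
  have hp1 := hh.isSeqPath (s := 0) (k := i) (by omega) (by omega)
  have hq := (hh.isSeqPath (s := i + 1) (k := n - i - 2) (by omega) (by omega)).reverse
  have hp2 := hq.cons (f (0 : ℕ))
    (fun j hj e => by have := hh.natCast_inj (by omega) (by omega) e; omega)
    (fun j hj => by rw [hh.natCast_adj_iff (by omega) (by omega)]; omega)
  have hp3 := (isSeqPath_zero (G := G) (fun _ => x)).cons (f (0 : ℕ))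
    (fun j hj e => hx.ne _ e.symm)
    (fun j hj => by rw [G.adj_comm, hA 0 (by omega)]; omega)
  have hm2 : ∀ w : V, w ∈ Set.range (fun j : Fin (n - i - 2 + 1 + 1) =>
      seqAppend 0 (fun _ => f (0 : ℕ)) (fun j => f ((i + 1 + (n - i - 2 - j) : ℕ) : ZMod n)) j.val) →
      w = f (0 : ℕ) ∨ ∃ j : ℕ, i < j ∧ j < n ∧ w = f j := by
    intro w hw
    rcases eq_or_exists_of_mem_range_cons hw with rfl | ⟨j, hj, rfl⟩
    · exact .inl rfl
    · exact .inr ⟨_, by omega, by omega, rfl⟩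
  have hm1 : ∀ w : V, w ∈ Set.range (fun j : Fin (i + 1) => f ((0 + j.val : ℕ) : ZMod n)) →
      ∃ j : ℕ, j ≤ i ∧ w = f j := by
    rintro w ⟨j, rfl⟩
    exact ⟨j, by omega, by simp⟩
  have hm3 : ∀ w : V, w ∈ Set.range (fun j : Fin (0 + 1 + 1) =>
      seqAppend 0 (fun _ => f (0 : ℕ)) (fun _ => x) j.val) → w = f (0 : ℕ) ∨ w = x := by
    intro w hw
    rcases eq_or_exists_of_mem_range_cons hw with rfl | ⟨j, hj, rfl⟩
    · exact .inl rfl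
    · exact .inr rfl
  refine hP ⟨f (0 : ℕ), f i, f (i + 1 : ℕ), x, _, _, _, _, _, _, hp1.isInducedPathMap,
    hp2.isInducedPathMap, hp3.isInducedPathMap, by simp, by simp [seqAppend], by simp [seqAppend],
    by simp, ?_, by simp [seqAppend], fun e => ?_, fun e => ?_, hx.ne _, ?_, ?_, ?_,
    Or.inl ⟨hi, by omega⟩, ?_, ?_, ?_, ?_, ?_, ?_⟩
  · simp [seqAppend]
  · have := hh.natCast_inj (by omega) (by omega) e; omega
  · have := hh.natCast_inj (by omega) (by omega) e; omega
  · rw [hh.natCast_adj_iff (by omega) (by omega)]; omega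
  · rw [G.adj_comm, hA _ (by omega)]; omega
  · rw [G.adj_comm, hA _ (by omega)]; omega
  · rintro w ⟨h1, h2⟩
    obtain ⟨j, hj, rfl⟩ := hm1 w h1
    rcases hm2 _ h2 with e | ⟨k, hk, hkn, e⟩
    · exact e
    · have := hh.natCast_inj (by omega) (by omega) e; omega
  · rintro w ⟨h1, h2⟩
    obtain ⟨j, hj, rfl⟩ := hm1 w h1
    rcases hm3 _ h2 with e | e
    · exact e
    · exact absurd e.symm (hx.ne _)
  · rintro w ⟨h1, h2⟩
    rcases hm3 _ h2 with e | rfl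
    · exact e
    · rcases hm2 _ h1 with e | ⟨k, hk, hkn, e⟩
      · exact e
      · exact absurd e (hx.ne _)
  · intro u w h1 h2 hu hw huw
    obtain ⟨j, hj, rfl⟩ := hm1 u h1
    obtain ⟨k, hk, hkn, rfl⟩ := (hm2 w h2).resolve_left hw
    rw [hh.natCast_adj_iff (by omega) (by omega)] at huw
    have : j ≠ 0 := by rintro rfl; exact hu rfl
    obtain ⟨rfl, rfl⟩ : j = i ∧ k = i + 1 := by omega
    exact ⟨rfl, rfl⟩
  · intro u w h1 h2 hu hw huw
    obtain ⟨j, hj, rfl⟩ := hm1 u h1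
    obtain rfl := (hm3 w h2).resolve_left hw
    rw [G.adj_comm, hA _ (by omega)] at huw
    have : j ≠ 0 := by rintro rfl; exact hu rfl
    obtain rfl : j = i := by omega
    exact ⟨rfl, rfl⟩
  · intro u w h1 h2 hu hw huw
    obtain ⟨k, hk, hkn, rfl⟩ := (hm2 u h1).resolve_left hu
    obtain rfl := (hm3 w h2).resolve_left hw
    rw [G.adj_comm, hA _ (by omega)] at huw
    obtain rfl : k = i + 1 := by omega
    exact ⟨rfl, rfl⟩

end Holes
section Links

variable {G : SimpleGraph V} {n : ℕ} {f : ZMod n → V} {x y : V}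

lemma exists_first {P : ℕ → Prop} {lo hi k : ℕ} (h1 : lo ≤ k) (h2 : k ≤ hi) (h3 : P k) :
    ∃ k, lo ≤ k ∧ k ≤ hi ∧ P k ∧ ∀ j, lo ≤ j → j < k → ¬ P j := by
  classical
  have hex : ∃ k, lo ≤ k ∧ k ≤ hi ∧ P k := ⟨k, h1, h2, h3⟩
  obtain ⟨a, b, c⟩ := Nat.find_spec hex
  exact ⟨_, a, b, c, fun j hj hjk hP => Nat.find_min hex hjk ⟨hj, by omega, hP⟩⟩

lemma exists_last {P : ℕ → Prop} {lo hi k : ℕ} (h1 : lo ≤ k) (h2 : k ≤ hi) (h3 : P k) :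
    ∃ k, lo ≤ k ∧ k ≤ hi ∧ P k ∧ ∀ j, k < j → j ≤ hi → ¬ P j := by
  obtain ⟨m, h4, h5, h6, h7⟩ := exists_first (P := fun i => P (hi - i)) (lo := 0) (hi := hi - lo)
    (k := hi - k) (by omega) (by omega) (by rwa [show hi - (hi - k) = k by omega])
  refine ⟨hi - m, by omega, by omega, h6, fun j hj hjh hP => h7 (hi - j) (by omega) (by omega) ?_⟩
  rwa [show hi - (hi - j) = j by omega]

/-- The stretch from position `s` to position `t` meets the neighbourhood of `x` exactly in `s`
and the neighbourhood of `y` exactly in `t`. -/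
def IsLink (G : SimpleGraph V) (f : ZMod n → V) (x y : V) (s t : ℕ) : Prop :=
  G.Adj x (f s) ∧ G.Adj y (f t) ∧ (∀ k : ℕ, s < k → k ≤ t → ¬ G.Adj x (f k)) ∧
    ∀ k : ℕ, s ≤ k → k < t → ¬ G.Adj y (f k)

lemma exists_isLink {a b : ℕ} (hab : a ≤ b) (ha : G.Adj x (f a)) (hb : G.Adj y (f b)) :
    ∃ s t, a ≤ s ∧ s ≤ t ∧ t ≤ b ∧ IsLink G f x y s t := by
  obtain ⟨t, h1, h2, h3, h4⟩ := exists_first (P := fun k : ℕ => G.Adj y (f k)) hab le_rfl hb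
  obtain ⟨s, h5, h6, h7, h8⟩ := exists_last (P := fun k : ℕ => G.Adj x (f k)) le_rfl h1 ha
  exact ⟨s, t, h5, h6, h2, h7, h3, h8, fun k hk => h4 k (by omega)⟩

/-- Two neighbours, of `x` and of `y`, at different positions bound a stretch containing a link. -/
lemma exists_isLink_or {lo hi a b : ℕ} (ha : G.Adj x (f a)) (hb : G.Adj y (f b))
    (h1 : lo ≤ a) (h2 : a ≤ hi) (h3 : lo ≤ b) (h4 : b ≤ hi) :
    ∃ s t, lo ≤ s ∧ s ≤ t ∧ t ≤ hi ∧ (IsLink G f x y s t ∨ IsLink G f y x s t) := by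
  rcases le_total a b with h | h
  · obtain ⟨s, t, h5, h6, h7, h8⟩ := exists_isLink h ha hb
    exact ⟨s, t, by omega, h6, by omega, .inl h8⟩
  · obtain ⟨s, t, h5, h6, h7, h8⟩ := exists_isLink h hb ha
    exact ⟨s, t, by omega, h6, by omega, .inr h8⟩

/-- A link, oriented from its neighbour of `x` to its neighbour of `y`. -/
lemma IsHole.exists_oriented_link (h : IsHole G n f) {s t : ℕ} (hs : 0 < s) (hst : s ≤ t)
    (ht : t < n) (hl : IsLink G f x y s t ∨ IsLink G f y x s t) :
    ∃ e : ℕ → ℕ, (∀ k ≤ t - s, s ≤ e k ∧ e k ≤ t ∧ (G.Adj x (f (e k)) ↔ k = 0) ∧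
      (G.Adj y (f (e k)) ↔ k = t - s)) ∧ IsSeqPath G (t - s) (fun k => f (e k)) := by
  have hp := h.isSeqPath (s := s) (k := t - s) (by omega) (by omega)
  rcases hl with ⟨h1, h2, h3, h4⟩ | ⟨h1, h2, h3, h4⟩
  · refine ⟨fun k => s + k, fun k hk => ?_, hp⟩
    dsimp only
    refine ⟨by omega, by omega, ⟨fun ha => ?_, ?_⟩, ⟨fun ha => ?_, ?_⟩⟩
    · by_contra hne
      exact h3 (s + k) (by omega) (by omega) ha
    · rintro rfl; exact h1
    · by_contra hne
      exact h4 (s + k) (by omega) (by omega) ha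
    · rintro rfl
      rwa [show s + (t - s) = t by omega]
  · refine ⟨fun k => s + (t - s - k), fun k hk => ?_, hp.reverse⟩
    dsimp only
    refine ⟨by omega, by omega, ⟨fun ha => ?_, ?_⟩, ⟨fun ha => ?_, ?_⟩⟩
    · by_contra hne
      exact h4 (s + (t - s - k)) (by omega) (by omega) ha
    · rintro rfl
      rwa [show s + (t - s - 0) = t by omega]
    · by_contra hne
      exact h3 (s + (t - s - k)) (by omega) (by omega) ha
    · rintro rfl
      rwa [show s + (t - s - (t - s)) = s by omega]

/-- A shortest odd hole in a graph with no jewel or pyramid, two nonadjacent major vertices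
`x` and `y`, and a link of odd length between them, from position `0` to position `q`. -/
structure OddLink (G : SimpleGraph V) (f : ZMod n → V) (x y : V) (q : ℕ) : Prop where
  noJewel : ¬ ContainsJewel G
  noPyramid : ¬ ContainsPyramid G
  shortest : IsShortestOddHole G n f
  majorLeft : IsCMajor G f x
  majorRight : IsCMajor G f y
  nonadj : ¬ G.Adj x y
  lt : q < n
  odd : Odd q
  link : IsLink G f x y 0 q

namespace OddLink

variable {q : ℕ}

lemma hole (h : OddLink G f x y q) : IsHole G n f := h.shortest.1.1

lemma odd_length (h : OddLink G f x y q) : Odd n := h.shortest.1.2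

lemma mirror (h : OddLink G f x y q) : OddLink G (fun i : ZMod n => f ((q : ZMod n) - i)) y x q := by
  obtain ⟨h1, h2, h3, h4⟩ := h.link
  have key : ∀ k : ℕ, k ≤ q → ((q : ZMod n) - k) = ((q - k : ℕ) : ZMod n) :=
    fun k hk => (Nat.cast_sub hk).symm
  refine ⟨h.noJewel, h.noPyramid, h.shortest.reflect _, h.majorRight.reflect _,
    h.majorLeft.reflect _, fun ha => h.nonadj ha.symm, h.lt, h.odd, ?_, ?_, ?_, ?_⟩
  · simpa using h2
  · simpa using h1
  · intro k hk hkq ha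
    simp only [key k hkq] at ha
    exact h4 _ (by omega) (by omega) ha
  · intro k hk hkq ha
    simp only [key k hkq.le] at ha
    exact h3 _ (by omega) (by omega) ha

lemma natCast_sub_eq {k : ℕ} (hk : k ≤ n + q) :
    (q : ZMod n) - k = ((n + q - k : ℕ) : ZMod n) := by
  rw [Nat.cast_sub hk]
  push_cast
  simp

lemma length_sub (h : OddLink G f x y q) : q + 4 ≤ n := by
  have h4 := h.hole.1
  have h5 := h.odd_length
  have h6 := h.odd
  have h7 := h.lt
  rw [Nat.odd_iff] at h5 h6
  by_contra hcon
  obtain rfl : n = q + 2 := by omega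
  obtain ⟨j, hj, ha, h1, h2, h3⟩ := h.majorLeft.exists_natCast h4 0
  by_cases hjq : j = q + 1
  · subst hjq
    apply h1
    have : ((q + 2 : ℕ) : ZMod (q + 2)) = 0 := ZMod.natCast_self _
    push_cast at this ⊢
    linear_combination this
  · by_cases hj0 : j = 0
    · subst hj0; simp at h2
    · exact h.link.2.2.1 j (by omega) (by omega) ha

lemma adj_zero (h : OddLink G f x y q) : G.Adj x (f (0 : ℕ)) := h.link.1

lemma adj_period (h : OddLink G f x y q) : G.Adj x (f n) := by
  simpa using h.link.1

/-- The first neighbour of `x` beyond the odd link has even position. -/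
lemma even_first (h : OddLink G f x y q) {a : ℕ} (hqa : q < a) (han : a ≤ n)
    (ha : G.Adj x (f a)) (hb : ∀ k : ℕ, q < k → k < a → ¬ G.Adj x (f k)) : Even a := by
  have h1 := h.odd.pos
  have := h.shortest.even_gap h.majorLeft (s := 0) (t := a) (by omega) (by omega) h.adj_zero ha
    (fun i hi hia => by
      rcases le_or_gt i q with hiq | hiq
      · exact h.link.2.2.1 i hi hiq
      · exact hb i hiq hia)
  simpa using this

lemma even_last (h : OddLink G f x y q) {b : ℕ} (hqb : q ≤ b) (hbn : b < n)
    (hb : G.Adj y (f b)) (hlast : ∀ k : ℕ, b < k → k < n → ¬ G.Adj y (f k)) : Even b := by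
  have h1 := h.odd
  have h2 := h.odd_length
  have h3 := h.mirror.even_first (a := n + q - b) (by omega) (by omega) (by
      rw [natCast_sub_eq (by omega), show n + q - (n + q - b) = b by omega]
      exact hb) (fun k hk hkn ha => by
      rw [natCast_sub_eq (by omega)] at ha
      exact hlast _ (by omega) (by omega) ha)
  rw [Nat.odd_iff] at *
  rw [Nat.even_iff] at *
  omega

lemma exists_left (h : OddLink G f x y q) :
    ∃ k : ℕ, q + 2 ≤ k ∧ k + 2 ≤ n ∧ G.Adj x (f k) := by
  by_contra hcon
  push Not at hcon
  have h4 := h.hole.1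
  have h5 := h.odd_length
  have h6 := h.odd
  have h7 := h.length_sub
  have hA : ∀ j : ℕ, j < n → G.Adj x (f j) → j = 0 ∨ j = q + 1 ∨ j + 1 = n := by
    intro j hj ha
    by_contra hne
    rcases le_or_gt j q with hjq | hjq
    · exact h.link.2.2.1 j (by omega) hjq ha
    · exact hcon j (by omega) (by omega) ha
  have hq1 : G.Adj x (f (q + 1 : ℕ)) := by
    obtain ⟨j, hj, ha, h1, h2, h3⟩ := h.majorLeft.exists_natCast h4 0
    rcases hA j hj ha with rfl | rfl | rfl
    · simp at h2
    · exact ha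
    · exfalso
      apply h1
      have : ((j + 1 : ℕ) : ZMod (j + 1)) = 0 := ZMod.natCast_self _
      push_cast at this ⊢
      linear_combination this
  have hn1 : G.Adj x (f (n - 1 : ℕ)) := by
    by_contra hno
    have := h.shortest.even_gap h.majorLeft (s := q + 1) (t := n) (by omega) (by omega) hq1
      h.adj_period (fun i hi hin ha => by
        rcases hA i hin ha with e | e | e
        · omega
        · omega
        · exact hno (by rwa [show n - 1 = i by omega]))
    rw [Nat.odd_iff] at *
    rw [Nat.even_iff] at this
    omega
  refine (h.shortest.shift (q + 1 : ℕ)).no_three_zero h.noPyramid (h.majorLeft.shift _)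
    (i := n - q - 2) (by rw [Nat.odd_iff] at *; omega) (by have := h.odd.pos; omega) ?_
  intro j hj
  rw [← Nat.cast_add]
  rcases lt_or_ge (q + 1 + j) n with hlt | hge
  · constructor
    · intro ha
      have := hA _ hlt ha
      omega
    · rintro (rfl | rfl | rfl)
      · exact hq1
      · rwa [show q + 1 + (n - q - 2) = n - 1 by omega]
      · omega
  · obtain ⟨k, hk⟩ := Nat.exists_eq_add_of_le hge
    have e : ((q + 1 + j : ℕ) : ZMod n) = (k : ℕ) := by rw [hk]; simp
    rw [e]
    constructor
    · intro ha
      have := hA _ (by omega) ha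
      omega
    · intro hj'
      obtain rfl : k = 0 := by omega
      exact h.adj_zero

lemma exists_right (h : OddLink G f x y q) :
    ∃ k : ℕ, q + 2 ≤ k ∧ k + 2 ≤ n ∧ G.Adj y (f k) := by
  obtain ⟨k, h1, h2, h3⟩ := h.mirror.exists_left
  refine ⟨n + q - k, by omega, by omega, ?_⟩
  rw [← natCast_sub_eq (by omega)]
  exact h3

/-- The hole through `x`, `y`, the odd link and a further even link is an odd hole. -/
lemma eq_of_even_link (h : OddLink G f x y q) {s t : ℕ} (hs : q + 2 ≤ s) (hst : s ≤ t)
    (ht : t + 2 ≤ n) (hev : Even (t - s)) (hl : IsLink G f x y s t ∨ IsLink G f y x s t) :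
    s = q + 2 ∧ t + 2 = n := by
  obtain ⟨e, he, hp⟩ := h.hole.exists_oriented_link (by omega) hst (by omega) hl
  obtain ⟨l1, l2, l3, l4⟩ := h.link
  have hlt := h.lt
  have hh := h.hole
  have hp1 := (isSeqPath_zero (G := G) (fun _ => y)).append
    (h.hole.isSeqPath (s := 0) (k := q) (by omega) (by omega)).reverse
    (fun i j hi hj => h.majorRight.ne _) (by
      intro i j hi hj
      constructor
      · intro ha
        by_contra hne
        exact l4 _ (by omega) (by omega) ha
      · rintro ⟨-, rfl⟩
        simpa using l2)
  have hp2 := hp.append hp1 (by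
      intro i j hi hj
      have := he i hi
      rcases Nat.eq_zero_or_pos j with rfl | hj0
      · rw [seqAppend_left (by omega)]
        exact (h.majorRight.ne _).symm
      · obtain ⟨k, rfl⟩ := Nat.exists_eq_add_of_le hj0
        rw [seqAppend_right]
        intro e1
        have := hh.natCast_inj (by omega) (by omega) e1
        omega) (by
      intro i j hi hj
      have hei := he i hi
      rcases Nat.eq_zero_or_pos j with rfl | hj0
      · rw [seqAppend_left (by omega), G.adj_comm, hei.2.2.2]
        simp
      · obtain ⟨k, rfl⟩ := Nat.exists_eq_add_of_le hj0
        rw [seqAppend_right, hh.natCast_adj_iff (by omega) (by omega)]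
        omega)
  have := h.shortest.le_of_isSeqPath hp2 (by omega) (by
      have := h.odd
      rw [Nat.odd_iff] at *
      rw [Nat.even_iff] at *
      omega) x (by
      intro i hi
      rcases le_or_gt i (t - s) with h1 | h1
      · rw [seqAppend_left h1]; exact h.majorLeft.ne _
      obtain ⟨k, rfl⟩ := Nat.exists_eq_add_of_le (show t - s + 1 ≤ i by omega)
      rw [seqAppend_right]
      rcases Nat.eq_zero_or_pos k with rfl | hj0
      · rw [seqAppend_left (by omega)]
        rintro rfl
        exact l3 q h.odd.pos le_rfl l2
      · obtain ⟨k, rfl⟩ := Nat.exists_eq_add_of_le hj0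
        rw [seqAppend_right]
        exact h.majorLeft.ne _) (by
      intro i hi
      rcases le_or_gt i (t - s) with h1 | h1
      · rw [seqAppend_left h1, (he i h1).2.2.1]
        omega
      obtain ⟨k, rfl⟩ := Nat.exists_eq_add_of_le (show t - s + 1 ≤ i by omega)
      rw [seqAppend_right]
      rcases Nat.eq_zero_or_pos k with rfl | hj0
      · rw [seqAppend_left (by omega)]
        have := h.nonadj
        simp only [this, false_iff]
        omega
      · obtain ⟨k, rfl⟩ := Nat.exists_eq_add_of_le hj0
        rw [seqAppend_right]
        constructor
        · intro ha
          by_contra hne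
          exact l3 _ (by omega) (by omega) ha
        · intro hk
          obtain rfl : k = q := by omega
          simpa using l1)
  omega

lemma no_jewel_pattern (h : OddLink G f x y q) (hn : n = q + 4)
    (hx1 : G.Adj x (f (q + 1 : ℕ))) (hx2 : G.Adj x (f (q + 2 : ℕ)))
    (hy1 : G.Adj y (f (q + 1 : ℕ))) (hy2 : G.Adj y (f (q + 2 : ℕ))) : False := by
  obtain ⟨l1, l2, l3, l4⟩ := h.link
  have hh := h.hole
  have hq := h.odd.pos
  have hp := (h.hole.isSeqPath (s := 0) (k := q) (by omega) (by omega)).reverse.append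
    (isSeqPath_zero (G := G) (fun _ => x))
    (fun i j hi hj => (h.majorLeft.ne _).symm) (by
      intro i j hi hj
      rw [G.adj_comm]
      constructor
      · intro ha
        by_contra hne
        exact l3 _ (by omega) (by omega) ha
      · rintro ⟨rfl, -⟩
        simpa using l1)
  have hxy : y ≠ x := by rintro rfl; exact l3 q hq le_rfl l2
  refine h.noJewel ⟨f q, y, f (q + 2 : ℕ), x, f (q + 1 : ℕ), _, _, ?_, l2.symm, hy2, hx2.symm, hx1,
    ?_, ?_, fun ha => h.nonadj ha.symm, fun ha => l3 q hq le_rfl ha.symm, hp.isInducedPathMap,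
    ?_, ?_, ?_⟩
  · simp only [List.pairwise_cons, List.mem_cons, List.not_mem_nil, or_false, forall_eq_or_imp,
      forall_eq, false_imp_iff, implies_true, List.Pairwise.nil, and_true]
    refine ⟨⟨(h.majorRight.ne _).symm, ?_, (h.majorLeft.ne _).symm, ?_⟩,
      ⟨h.majorRight.ne _, hxy, h.majorRight.ne _⟩, ⟨(h.majorLeft.ne _).symm, ?_⟩,
      h.majorLeft.ne _⟩
    all_goals
      intro e
      have := hh.natCast_inj (by omega) (by omega) e
      omega
  · rw [hh.natCast_adj_iff (by omega) (by omega)]; omega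
  · rw [hh.natCast_adj_iff (by omega) (by omega)]; omega
  · simp [seqAppend]
  · simp [seqAppend]
  · intro i hi0 hil
    have h1 : i.val ≠ 0 := fun e => hi0 (Fin.ext (by simpa using e))
    have h2 : i.val ≠ q + 1 + 0 := fun e => hil (Fin.ext (by simpa using e))
    have h3 := i.2
    rw [seqAppend_left (by omega)]
    refine ⟨l4 _ (by omega) (by omega), ?_, ?_⟩ <;>
    · rw [hh.natCast_adj_iff (by omega) (by omega)]; omega

lemma no_even_link (h : OddLink G f x y q) {s t : ℕ} (hs : q + 2 ≤ s) (hst : s ≤ t)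
    (ht : t + 2 ≤ n) (hev : Even (t - s)) (hl : IsLink G f x y s t ∨ IsLink G f y x s t) :
    False := by
  obtain ⟨rfl, rfl⟩ := h.eq_of_even_link hs hst ht hev hl
  obtain ⟨l1, l2, l3, l4⟩ := h.link
  have hq := h.odd
  have hn := h.odd_length
  have hq0 := h.odd.pos
  rw [Nat.odd_iff] at hq hn
  rw [Nat.even_iff] at hev
  have hx1 : G.Adj x (f (q + 2 : ℕ)) → G.Adj x (f (q + 1 : ℕ)) := by
    intro ha
    by_contra hno
    have := h.even_first (a := q + 2) (by omega) (by omega) ha (fun k hk hk2 hak => by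
      obtain rfl : k = q + 1 := by omega
      exact hno hak)
    rw [Nat.even_iff] at this
    omega
  have hpyr : G.Adj x (f (q + 2 : ℕ)) → ¬ G.Adj x (f (t + 1 : ℕ)) →
      (∀ k : ℕ, q + 2 < k → k ≤ t → ¬ G.Adj x (f k)) → False := by
    intro ha hno hbt
    refine h.shortest.no_three_zero h.noPyramid h.majorLeft (i := q + 1) (by omega) (by omega) ?_
    intro j hj
    constructor
    · intro haj
      by_contra hne
      rcases le_or_gt j q with hjq | hjq
      · exact l3 j (by omega) hjq haj
      · rcases eq_or_ne j (t + 1) with rfl | hjt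
        · exact hno haj
        · exact hbt j (by omega) (by omega) haj
    · rintro (rfl | rfl | rfl)
      · exact l1
      · exact hx1 ha
      · exact ha
  rcases eq_or_ne t (q + 2) with rfl | hne
  · have hxy : G.Adj x (f (q + 2 : ℕ)) ∧ G.Adj y (f (q + 2 : ℕ)) := by
      rcases hl with hl | hl
      · exact ⟨hl.1, hl.2.1⟩
      · exact ⟨hl.2.1, hl.1⟩
    have hy1 : G.Adj y (f (q + 1 : ℕ)) := by
      by_contra hno
      have hy3 : G.Adj y (f (q + 3 : ℕ)) := by
        by_contra hno3
        have := h.even_last (b := q + 2) (by omega) (by omega) hxy.2 (fun k hk hk2 ha => by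
          obtain rfl : k = q + 3 := by omega
          exact hno3 ha)
        rw [Nat.even_iff] at this
        omega
      refine (h.shortest.shift (q : ℕ)).no_three_zero h.noPyramid (h.majorRight.shift _) (i := 2)
        le_rfl (by omega) ?_
      intro j hj
      rw [← Nat.cast_add]
      rcases lt_or_ge (q + j) (q + 2 + 2) with hlt | hge
      · have : j < 4 := by omega
        interval_cases j
        · simpa using l2
        · simpa using hno
        · simpa using hxy.2
        · simpa using hy3
      · obtain ⟨k, hk⟩ := Nat.exists_eq_add_of_le hge
        have e : ((q + j : ℕ) : ZMod (q + 2 + 2)) = (k : ℕ) := by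
          rw [hk, Nat.cast_add, ZMod.natCast_self, zero_add]
        rw [e]
        have := l4 k (by omega) (by omega)
        simp only [this, false_iff]
        omega
    exact h.no_jewel_pattern rfl (hx1 hxy.1) hxy.1 hy1 hxy.2
  · rcases hl with hl | hl
    · refine hpyr hl.1 (fun ha => ?_) hl.2.2.1
      have := h.shortest.even_gap h.majorLeft (s := q + 2) (t := t + 1) (by omega) (by omega)
        hl.1 ha (fun i hi hit => hl.2.2.1 i hi (by omega))
      rw [Nat.even_iff] at this
      omega
    · by_cases ha : G.Adj x (f (q + 1 : ℕ))
      · have := h.shortest.even_gap h.majorLeft (s := q + 1) (t := t) (by omega) (by omega)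
          ha hl.2.1 (fun i hi hit => hl.2.2.2 i (by omega) hit)
        rw [Nat.even_iff] at this
        omega
      · have := h.even_first (a := t) (by omega) (by omega) hl.2.1 (fun k hk hkt hak => by
          rcases eq_or_ne k (q + 1) with rfl | hkq
          · exact ha hak
          · exact hl.2.2.2 k (by omega) hkt hak)
        rw [Nat.even_iff] at this
        omega

/-- If `y` is adjacent to position `q + 1`, a link from there to `r` together with a
further link far from it would give a pyramid with apex `x`. -/
lemma no_pyramid_pattern (h : OddLink G f x y q) {r s t : ℕ} (hqr : q + 1 ≤ r)
    (hl : IsLink G f y x (q + 1) r) (hrs : r + 2 ≤ s) (hst : s ≤ t) (ht : t + 2 ≤ n)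
    (hl' : IsLink G f x y s t ∨ IsLink G f y x s t) : False := by
  obtain ⟨e, he, hp⟩ := h.hole.exists_oriented_link (by omega) hst (by omega) hl'
  obtain ⟨l1, l2, l3, l4⟩ := h.link
  obtain ⟨m1, m2, m3, m4⟩ := hl
  have hq0 := h.odd.pos
  have hh := h.hole
  have hxy : x ≠ y := by rintro rfl; exact l3 q hq0 le_rfl l2
  have hp1 := (hh.isSeqPath (s := 0) (k := q) (by omega) (by omega)).cons x
    (fun i _ => h.majorLeft.ne _) (by
      intro i hi
      constructor
      · intro ha
        by_contra hne
        exact l3 _ (by omega) (by omega) ha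
      · rintro rfl
        exact l1)
  have hp2 := (hh.isSeqPath (s := q + 1) (k := r - q - 1) (by omega) (by omega)).reverse.cons x
    (fun i _ => h.majorLeft.ne _) (by
      intro i hi
      constructor
      · intro ha
        by_contra hne
        exact m4 _ (by omega) (by omega) ha
      · rintro rfl
        rwa [show q + 1 + (r - q - 1 - 0) = r by omega])
  have hp3 := (hp.append (isSeqPath_zero (G := G) (fun _ => y))
    (fun i j _ _ => (h.majorRight.ne _).symm) (by
      intro i j hi hj
      rw [G.adj_comm, (he i hi).2.2.2]
      omega)).cons x (by
      intro i hi
      rcases le_or_gt i (t - s) with h1 | h1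
      · rw [seqAppend_left h1]; exact h.majorLeft.ne _
      · obtain ⟨k, rfl⟩ := Nat.exists_eq_add_of_le (show t - s + 1 ≤ i by omega)
        rw [seqAppend_right]; exact hxy) (by
      intro i hi
      rcases le_or_gt i (t - s) with h1 | h1
      · rw [seqAppend_left h1, (he i h1).2.2.1]
      · obtain ⟨k, rfl⟩ := Nat.exists_eq_add_of_le (show t - s + 1 ≤ i by omega)
        rw [seqAppend_right]
        simp only [h.nonadj, false_iff]
        omega)
  have hm1 : ∀ w, w ∈ Set.range (fun j : Fin (q + 1 + 1) =>
      seqAppend 0 (fun _ => x) (fun i => f ((0 + i : ℕ) : ZMod n)) j.val) →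
      w = x ∨ ∃ k : ℕ, k ≤ q ∧ w = f k := by
    intro w hw
    rcases eq_or_exists_of_mem_range_cons hw with rfl | ⟨j, hj, rfl⟩
    · exact .inl rfl
    · exact .inr ⟨_, by omega, rfl⟩
  have hm2 : ∀ w, w ∈ Set.range (fun j : Fin (r - q - 1 + 1 + 1) =>
      seqAppend 0 (fun _ => x)
        (fun i => f ((q + 1 + (r - q - 1 - i) : ℕ) : ZMod n)) j.val) →
      w = x ∨ ∃ k : ℕ, q < k ∧ k ≤ r ∧ w = f k := by
    intro w hw
    rcases eq_or_exists_of_mem_range_cons hw with rfl | ⟨j, hj, rfl⟩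
    · exact .inl rfl
    · exact .inr ⟨_, by omega, by omega, rfl⟩
  have hm3 : ∀ w, w ∈ Set.range (fun j : Fin (t - s + 1 + 0 + 1 + 1) =>
      seqAppend 0 (fun _ => x)
        (seqAppend (t - s) (fun k => f (e k)) (fun _ => y)) j.val) →
      w = x ∨ w = y ∨ ∃ k : ℕ, s ≤ k ∧ k ≤ t ∧ w = f k := by
    intro w hw
    rcases eq_or_exists_of_mem_range_cons hw with rfl | ⟨i, hi, rfl⟩
    · exact .inl rfl
    · right
      rcases le_or_gt i (t - s) with h1 | h1
      · rw [seqAppend_left h1]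
        exact .inr ⟨_, (he i h1).1, (he i h1).2.1, rfl⟩
      · obtain ⟨k, rfl⟩ := Nat.exists_eq_add_of_le (show t - s + 1 ≤ i by omega)
        rw [seqAppend_right]
        exact .inl rfl
  refine h.noPyramid ⟨x, f q, f (q + 1 : ℕ), y, _, _, _, _, _, _, hp1.isInducedPathMap,
    hp2.isInducedPathMap, hp3.isInducedPathMap, by simp [seqAppend], by simp [seqAppend],
    by simp [seqAppend], by simp [seqAppend], by simp [seqAppend], by simp [seqAppend],
    (h.majorLeft.ne _).symm, (h.majorLeft.ne _).symm, hxy.symm, ?_, l2.symm, m1.symm,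
    .inr (.inl ⟨by omega, by omega⟩), ?_, ?_, ?_, ?_, ?_, ?_⟩
  · rw [hh.natCast_adj_iff (by omega) (by omega)]; omega
  · rintro w ⟨h1, h2⟩
    rcases hm1 w h1 with h3 | ⟨j, hj, rfl⟩
    · exact h3
    rcases hm2 _ h2 with h3 | ⟨k, hk, hkr, e1⟩
    · exact h3
    have := hh.natCast_inj (by omega) (by omega) e1
    omega
  · rintro w ⟨h1, h2⟩
    rcases hm1 w h1 with h3 | ⟨j, hj, rfl⟩
    · exact h3
    rcases hm3 _ h2 with h3 | h3 | ⟨k, hk, hkr, e1⟩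
    · exact h3
    · exact absurd h3.symm (h.majorRight.ne _)
    have := hh.natCast_inj (by omega) (by omega) e1
    omega
  · rintro w ⟨h1, h2⟩
    rcases hm2 w h1 with h3 | ⟨j, hj, hjr, rfl⟩
    · exact h3
    rcases hm3 _ h2 with h3 | h3 | ⟨k, hk, hkr, e1⟩
    · exact h3
    · exact absurd h3.symm (h.majorRight.ne _)
    have := hh.natCast_inj (by omega) (by omega) e1
    omega
  · intro u w h1 h2 hu hw huw
    obtain ⟨j, hj, rfl⟩ := (hm1 u h1).resolve_left hu
    obtain ⟨k, hk, hkr, rfl⟩ := (hm2 w h2).resolve_left hw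
    rw [hh.natCast_adj_iff (by omega) (by omega)] at huw
    obtain ⟨rfl, rfl⟩ : j = q ∧ k = q + 1 := by omega
    exact ⟨rfl, rfl⟩
  · intro u w h1 h2 hu hw huw
    obtain ⟨j, hj, rfl⟩ := (hm1 u h1).resolve_left hu
    rcases (hm3 w h2).resolve_left hw with rfl | ⟨k, hk, hkr, rfl⟩
    · obtain rfl : j = q := by
        by_contra hne
        exact l4 j (by omega) (by omega) huw.symm
      exact ⟨rfl, rfl⟩
    · rw [hh.natCast_adj_iff (by omega) (by omega)] at huw
      omega
  · intro u w h1 h2 hu hw huw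
    obtain ⟨j, hj, hjr, rfl⟩ := (hm2 u h1).resolve_left hu
    rcases (hm3 w h2).resolve_left hw with rfl | ⟨k, hk, hkr, rfl⟩
    · obtain rfl : j = q + 1 := by
        by_contra hne
        exact m3 j (by omega) (by omega) huw.symm
      exact ⟨rfl, rfl⟩
    · rw [hh.natCast_adj_iff (by omega) (by omega)] at huw
      omega

/-- No link starts right after the odd link. -/
lemma no_link_succ (h : OddLink G f x y q) {r : ℕ} (hqr : q + 1 ≤ r) (hrn : r < n)
    (hl : IsLink G f y x (q + 1) r) : False := by
  have hnp := fun {s t : ℕ} => h.no_pyramid_pattern (s := s) (t := t) hqr hl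
  obtain ⟨m1, m2, m3, m4⟩ := hl
  obtain ⟨l1, l2, l3, l4⟩ := h.link
  have hq := h.odd
  have hn := h.odd_length
  have hq0 := h.odd.pos
  rw [Nat.odd_iff] at hq hn
  obtain ⟨c, hc1, hc2, hc⟩ := h.exists_left
  obtain ⟨d, hd1, hd2, hd⟩ := h.exists_right
  have hrc : r ≤ c := by
    by_contra hcon
    exact m4 c (by omega) (by omega) hc
  have hrd : r < d := by
    by_contra hcon
    exact m3 d (by omega) (by omega) hd
  have hrev := h.even_first (a := r) (by omega) (by omega) m2
    (fun k hk hkr => m4 k (by omega) hkr)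
  rw [Nat.even_iff] at hrev
  obtain ⟨b, hrb, hbd, hb, hbf⟩ := exists_first (P := fun k : ℕ => G.Adj y (f k))
    (show r + 1 ≤ d by omega) (le_refl d) hd
  obtain ⟨a, hra, hab, ha, haf⟩ := exists_last (P := fun k : ℕ => G.Adj x (f k))
    (le_refl r) (show r ≤ b by omega) m2
  rcases eq_or_lt_of_le hra with rfl | hra'
  · rcases eq_or_lt_of_le hqr with rfl | hqr'
    · have hbc : b < c := by
        by_contra hcon
        exact haf c (by omega) (by omega) hc
      obtain rfl : b = q + 2 := by
        by_contra hne
        obtain ⟨s, t, h1, h2, h3, h4⟩ := exists_isLink hbc.le hb hc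
        exact hnp (by omega) h2 (by omega) (.inr h4)
      have hyR : ∀ k : ℕ, q + 3 ≤ k → k + 2 ≤ n → ¬ G.Adj y (f k) := by
        intro k hk1 hk2 hak
        obtain ⟨s, t, h1, h2, h3, h4⟩ := exists_isLink_or (lo := q + 3) (hi := n - 2) hc hak
          (by omega) (by omega) hk1 (by omega)
        exact hnp (by omega) h2 (by omega) h4
      obtain ⟨k, hkn, hak, h1, h2, h3⟩ := h.majorRight.exists_natCast h.hole.1 (q + 1 : ℕ)
      rcases le_or_gt k (q + 2) with hk | hk
      · rcases lt_or_ge k q with hkq | hkq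
        · exact l4 k (by omega) hkq hak
        · obtain rfl | rfl | rfl : k = q ∨ k = q + 1 ∨ k = q + 2 := by omega
          · exact h1 (by push_cast; ring)
          · exact h2 rfl
          · exact h3 (by push_cast; ring)
      · obtain rfl : n = k + 1 := by
          by_contra hne
          exact hyR k (by omega) (by omega) hak
        have := h.shortest.even_gap h.majorRight (s := q + 2) (t := k) (by omega) (by omega)
          hb hak (fun i hi hik => hyR i (by omega) (by omega))
        rw [Nat.even_iff] at this
        omega
    · have hyb : ∀ k : ℕ, q + 1 < k → k < b → ¬ G.Adj y (f k) := by
        intro k hk hkb hak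
        rcases le_or_gt k r with hkr | hkr
        · exact m3 k hk hkr hak
        · exact hbf k hkr hkb hak
      have := h.shortest.even_gap h.majorRight (s := q + 1) (t := b) (by omega) (by omega) m1 hb hyb
      rw [Nat.even_iff] at this
      exact h.no_even_link (s := r) (t := b) (by omega) (by omega) (by omega)
        (by rw [Nat.even_iff]; omega) (.inl ⟨ha, hb, haf, fun k hk => hyb k (by omega)⟩)
  · have hlab : IsLink G f x y a b := ⟨ha, hb, haf, fun k hk => hbf k (by omega)⟩
    rcases eq_or_lt_of_le (show r + 1 ≤ a from hra') with rfl | hra2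
    · have hb2 : r + 2 ≤ b := by
        by_contra hcon
        exact h.no_even_link (s := r + 1) (t := b) (by omega) (by omega) (by omega)
          (by rw [Nat.even_iff]; omega) (.inl hlab)
      have hxR : ∀ k : ℕ, r + 2 ≤ k → k + 2 ≤ n → ¬ G.Adj x (f k) := by
        intro k hk1 hk2 hak
        rcases le_or_gt k b with hkb | hkb
        · exact haf k (by omega) hkb hak
        · obtain ⟨s, t, h1, h2, h3, h4⟩ := exists_isLink hkb.le hb hak
          exact hnp (by omega) h2 (by omega) (.inr h4)
      refine h.shortest.no_three_zero h.noPyramid h.majorLeft (i := r) (by omega) (by omega) ?_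
      intro j hj
      constructor
      · intro haj
        by_contra hne
        rcases le_or_gt j q with hjq | hjq
        · exact l3 j (by omega) hjq haj
        rcases lt_or_ge j r with hjr | hjr
        · exact m4 j (by omega) hjr haj
        obtain rfl : n = j + 1 := by
          by_contra hne'
          exact hxR j (by omega) (by omega) haj
        have := h.shortest.even_gap h.majorLeft (s := r + 1) (t := j) (by omega) (by omega)
          ha haj (fun i hi hij => hxR i (by omega) (by omega))
        rw [Nat.even_iff] at this
        omega
      · rintro (rfl | rfl | rfl)
        · exact l1
        · exact m2
        · exact ha
    · exact hnp (by omega) hab (by omega) (.inl hlab)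

lemma no_link_pred (h : OddLink G f x y q) {s t : ℕ} (hqs : q < s) (hst : s ≤ t) (ht : n = t + 1)
    (hl : IsLink G f y x s t) : False := by
  obtain ⟨m1, m2, m3, m4⟩ := hl
  refine h.mirror.no_link_succ (r := n + q - s) (by omega) (by omega) ⟨?_, ?_, ?_, ?_⟩
  · dsimp only
    rw [natCast_sub_eq (by omega), show n + q - (q + 1) = t by omega]
    exact m2
  · dsimp only
    rw [natCast_sub_eq (by omega), show n + q - (n + q - s) = s by omega]
    exact m1
  · intro k hk hks ha
    dsimp only at ha
    rw [natCast_sub_eq (by omega)] at ha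
    exact m4 _ (by omega) (by omega) ha
  · intro k hk hks ha
    dsimp only at ha
    rw [natCast_sub_eq (by omega)] at ha
    exact m3 _ (by omega) (by omega) ha

/-- All links outside the odd link that lead from `y` to `x` have odd length. -/
lemma odd_of_isLink_right_left (h : OddLink G f x y q) {s t : ℕ} (hqs : q ≤ s) (hst : s ≤ t)
    (ht : t ≤ n) (hl : IsLink G f y x s t) : Odd (t - s) := by
  by_contra hev
  have hq := h.odd
  have hn := h.odd_length
  rw [Nat.not_odd_iff_even, Nat.even_iff] at hev
  rw [Nat.odd_iff] at hq hn
  have hqt : q < t := by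
    by_contra hcon
    exact h.link.2.2.1 t (by have := h.odd.pos; omega) (by omega) hl.2.1
  rcases eq_or_lt_of_le hqs with rfl | hqs'
  · have := h.even_first hqt ht hl.2.1 (fun k hk hkt => hl.2.2.2 k (by omega) hkt)
    rw [Nat.even_iff] at this
    omega
  rcases eq_or_lt_of_le ht with rfl | ht'
  · have hst' : s < t := by
      by_contra hcon
      obtain rfl : s = t := by omega
      exact h.link.2.2.2 0 le_rfl h.odd.pos (by simpa using hl.1)
    have := h.even_last hqs hst' hl.1 (fun k hk hkt => hl.2.2.1 k hk hkt.le)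
    rw [Nat.even_iff] at this
    omega
  rcases eq_or_lt_of_le (show q + 1 ≤ s from hqs') with rfl | hqs2
  · exact h.no_link_succ hst ht' hl
  rcases eq_or_lt_of_le (show t + 1 ≤ n from ht') with ht2 | ht2
  · exact h.no_link_pred hqs' hst ht2.symm hl
  exact h.no_even_link hqs2 hst ht2 (by rwa [Nat.even_iff]) (.inr hl)

/-- All links outside the odd link that lead from `x` to `y` have odd length. -/
lemma odd_of_isLink_left_right (h : OddLink G f x y q) {s t : ℕ} (hqs : q < s) (hst : s ≤ t)
    (ht : t < n) (hl : IsLink G f x y s t) : Odd (t - s) := by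
  by_contra hev
  have hq := h.odd
  have hn := h.odd_length
  have hl2 := h.length_sub
  rw [Nat.not_odd_iff_even, Nat.even_iff] at hev
  rw [Nat.odd_iff] at hq hn
  rcases eq_or_lt_of_le hst with rfl | hst'
  · have := h.odd_of_isLink_right_left hqs.le le_rfl ht.le
      ⟨hl.2.1, hl.1, fun k _ _ => by omega, fun k _ _ => by omega⟩
    rw [Nat.odd_iff] at this
    omega
  rcases eq_or_lt_of_le (show q + 1 ≤ s from hqs) with rfl | hqs2
  · have := h.shortest.even_gap h.majorRight (s := q) (t := t) (by omega) (by omega)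
      h.link.2.1 hl.2.1 (fun i hi hit => hl.2.2.2 i hi hit)
    rw [Nat.even_iff] at this
    omega
  rcases eq_or_lt_of_le (show t + 1 ≤ n from ht) with rfl | ht2
  · have := h.shortest.even_gap h.majorLeft (s := s) (t := t + 1) (by omega) (by omega)
      hl.1 h.adj_period (fun i hi hit => hl.2.2.1 i hi (by omega))
    rw [Nat.even_iff] at this
    omega
  exact h.no_even_link hqs2 hst ht2 (by rwa [Nat.even_iff]) (.inl hl)

/-- No link from `y` to `x` outside the odd link starts at an even position. -/
lemma not_even_link_start (h : OddLink G f x y q) : ∀ b a : ℕ, q ≤ b → b ≤ a → a ≤ n →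
    IsLink G f y x b a → ¬ Even b := by
  intro b
  induction b using Nat.strong_induction_on with
  | _ b ih =>
  intro a hqb hba han hl hbev
  have hodd := h.odd_of_isLink_right_left hqb hba han hl
  rw [Nat.odd_iff] at hodd
  have hq := h.odd
  rw [Nat.odd_iff] at hq
  rw [Nat.even_iff] at hbev
  by_cases hex : ∃ k : ℕ, q < k ∧ k < b ∧ G.Adj x (f k)
  · obtain ⟨k, hk1, hk2, hk⟩ := hex
    obtain ⟨c, hc1, hc2, hc, hclast⟩ := exists_last (P := fun k : ℕ => G.Adj x (f k))
      (show q + 1 ≤ k from hk1) (show k ≤ b by omega) hk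
    have hcb : c < b := by
      by_contra hcon
      obtain rfl : c = b := by omega
      exact hl.2.2.2 c le_rfl (by omega) hc
    have hca := h.shortest.even_gap h.majorLeft (s := c) (t := a) (by omega) (by omega) hc hl.2.1
      (fun i hi hia => by
        rcases le_or_gt i b with hib | hib
        · exact hclast i hi hib
        · exact hl.2.2.2 i hib.le hia)
    obtain ⟨d, hd1, hd2, hd, hdfirst⟩ := exists_first (P := fun k : ℕ => G.Adj y (f k))
      hcb.le le_rfl hl.1
    have hcd := h.odd_of_isLink_left_right (s := c) (t := d) (by omega) hd1 (by omega)
      ⟨hc, hd, fun k hk hkd => hclast k hk (by omega), hdfirst⟩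
    obtain ⟨e, he1, he2, he, helast⟩ := exists_last (P := fun k : ℕ => G.Adj y (f k))
      (le_refl q) (show q ≤ c by omega) h.link.2.1
    have hec : e < c := by
      by_contra hcon
      obtain rfl : e = c := by omega
      obtain rfl : d = e := by
        by_contra hne
        exact hdfirst e le_rfl (by omega) he
      simp at hcd
    rw [Nat.odd_iff] at hcd
    have hed := h.shortest.even_gap h.majorRight (s := e) (t := d) (by omega) (by omega) he hd
      (fun i hi hid => by
        rcases le_or_gt i c with hic | hic
        · exact helast i hi hic
        · exact hdfirst i hic.le hid)
    obtain ⟨g, hg1, hg2, hg, hgfirst⟩ := exists_first (P := fun k : ℕ => G.Adj x (f k))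
      hec.le le_rfl hc
    rw [Nat.even_iff] at hca hed
    exact ih e (by omega) g he1 hg1 (by omega)
      ⟨he, hg, fun k hk hkg => helast k hk (by omega), hgfirst⟩ (by rw [Nat.even_iff]; omega)
  · push Not at hex
    have := h.even_first (a := a) (by omega) han hl.2.1 (fun k hk hka => by
      rcases lt_or_ge k b with hkb | hkb
      · exact hex k hk hkb
      · exact hl.2.2.2 k hkb hka)
    rw [Nat.even_iff] at this
    omega

lemma false (h : OddLink G f x y q) : False := by
  obtain ⟨b, hb1, hb2, hb, hblast⟩ := exists_last (P := fun k : ℕ => G.Adj y (f k))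
    (le_refl q) (show q ≤ n - 1 by have := h.lt; omega) h.link.2.1
  have hq := h.odd.pos
  have hlt := h.lt
  obtain ⟨a, ha1, ha2, ha, hafirst⟩ := exists_first (P := fun k : ℕ => G.Adj x (f k))
    (show b ≤ n by omega) le_rfl h.adj_period
  have hbev := h.even_last hb1 (by omega) hb (fun k hk hkn => hblast k hk (by omega))
  refine h.not_even_link_start b a hb1 ha1 ha2 ⟨hb, ha, fun k hk hka hak => ?_, hafirst⟩ hbev
  rcases lt_or_ge k n with hkn | hkn
  · exact hblast k hk (by omega) hak
  · obtain rfl : k = n := by omega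
    exact h.link.2.2.2 0 le_rfl hq (by simpa using hak)

end OddLink

end Links

section Counting

open Finset

variable {G : SimpleGraph V} {n : ℕ} {f : ZMod n → V}

lemma sum_zmod_eq_sum_range {M : Type*} [AddCommMonoid M] [NeZero n] (g : ZMod n → M) :
    ∑ i, g i = ∑ k ∈ range n, g k := by
  refine (sum_nbij (fun k : ℕ => (k : ZMod n)) (fun _ _ => mem_univ _) ?_ ?_
    (fun _ _ => rfl)).symm
  · intro i hi j hj e
    simp only [coe_range, Set.mem_Iio] at hi hj
    exact (natCast_zmod_eq_iff hi hj).1 e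
  · intro j _
    exact ⟨j.val, by simpa using j.val_lt, ZMod.natCast_zmod_val j⟩

/-- Links between nonadjacent major vertices have even length. -/
lemma even_of_isLink (hJ : ¬ ContainsJewel G) (hP : ¬ ContainsPyramid G)
    (h : IsShortestOddHole G n f) {x y : V} (hx : IsCMajor G f x) (hy : IsCMajor G f y)
    (hxy : ¬ G.Adj x y) {s t : ℕ} (hst : s ≤ t) (ht : t < s + n) (hl : IsLink G f x y s t) :
    Even (t - s) := by
  by_contra hodd
  rw [Nat.not_even_iff_odd] at hodd
  obtain ⟨h1, h2, h3, h4⟩ := hl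
  have key : ∀ k : ℕ, (s : ZMod n) + k = ((s + k : ℕ) : ZMod n) := fun k => by push_cast; rfl
  refine OddLink.false (f := fun i => f ((s : ZMod n) + i)) (q := t - s)
    ⟨hJ, hP, h.shift _, hx.shift _, hy.shift _, hxy, by omega, hodd, ?_, ?_, ?_, ?_⟩
  · simpa using h1
  · simp only [key]
    rwa [show s + (t - s) = t by omega]
  · intro k hk hkt ha
    simp only [key] at ha
    exact h3 _ (by omega) (by omega) ha
  · intro k hk hkt ha
    simp only [key] at ha
    exact h4 _ (by omega) (by omega) ha

open Classical in
/-- The indicator, modulo two, of the edges of the hole with a common neighbour in `Y`. -/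
noncomputable def commonNeighbor (G : SimpleGraph V) (f : ZMod n → V) (Y : Finset V)
    (i : ZMod n) : ZMod 2 :=
  if ∃ z ∈ Y, G.Adj z (f i) ∧ G.Adj z (f (i + 1)) then 1 else 0

/-- Between consecutive positions with a neighbour in a stable set `Y` of major vertices, the
number of edges with a common neighbour in `Y` has the parity of the length. -/
lemma sum_commonNeighbor_consecutive (hJ : ¬ ContainsJewel G) (hP : ¬ ContainsPyramid G)
    (h : IsShortestOddHole G n f) {Y : Finset V} (hmaj : ∀ x ∈ Y, IsCMajor G f x)
    (hstab : ∀ x ∈ Y, ∀ y ∈ Y, ¬ G.Adj x y) {s d : ℕ} (hd : 0 < d) (hdn : d ≤ n)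
    (hs : ∃ x ∈ Y, G.Adj x (f s)) (ht : ∃ x ∈ Y, G.Adj x (f (s + d : ℕ)))
    (hb : ∀ i : ℕ, s < i → i < s + d → ¬ ∃ x ∈ Y, G.Adj x (f i)) :
    ∑ i ∈ range d, commonNeighbor G f Y (s + i : ℕ) = d := by
  obtain ⟨x, hx, hxs⟩ := hs
  obtain ⟨y, hy, hyt⟩ := ht
  have hn := h.1.1.1
  have hlink : ¬ G.Adj x (f (s + d : ℕ)) → ¬ G.Adj y (f s) → Even d := by
    intro h1 h2
    have hdn' : d ≠ n := by
      rintro rfl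
      exact h1 (by simpa using hxs)
    have := even_of_isLink hJ hP h (hmaj x hx) (hmaj y hy) (hstab x hx y hy)
      (s := s) (t := s + d) (by omega) (by omega) ⟨hxs, hyt, ?_, ?_⟩
    · simpa using this
    · intro k hk hkd ha
      rcases eq_or_lt_of_le hkd with rfl | hkd
      · exact h1 ha
      · exact hb k hk hkd ⟨x, hx, ha⟩
    · intro k hk hkd ha
      rcases eq_or_lt_of_le hk with rfl | hk
      · exact h2 ha
      · exact hb k hk hkd ⟨y, hy, ha⟩
  rcases eq_or_lt_of_le (show 1 ≤ d from hd) with rfl | hd2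
  · have hex : ∃ z ∈ Y, G.Adj z (f s) ∧ G.Adj z (f (s + 1 : ℕ)) := by
      by_contra hcon
      push Not at hcon
      have := hlink (hcon x hx hxs) (fun ha => hcon y hy ha hyt)
      simp at this
    have : commonNeighbor G f Y s = 1 := if_pos (by push_cast at hex; exact hex)
    simp [this]
  · have heven : Even d := by
      by_contra hodd
      have hgap : ∀ z ∈ Y, G.Adj z (f s) → ¬ G.Adj z (f (s + d : ℕ)) := by
        intro z hz h1 h2
        have := h.even_gap (hmaj z hz) (s := s) (t := s + d) (by omega) (by omega) h1 h2
          (fun i hi hid ha => hb i hi hid ⟨z, hz, ha⟩)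
        exact hodd (by simpa using this)
      exact hodd (hlink (hgap x hx hxs) (fun ha => hgap y hy ha hyt))
    rw [(ZMod.natCast_eq_zero_iff_even).2 heven]
    refine sum_eq_zero fun i hi => if_neg ?_
    rw [mem_range] at hi
    rintro ⟨z, hz, h1, h2⟩
    rcases Nat.eq_zero_or_pos i with rfl | hi0
    · exact hb (s + 0 + 1) (by omega) (by omega) ⟨z, hz, by push_cast at h2 ⊢; exact h2⟩
    · exact hb (s + i) (by omega) (by omega) ⟨z, hz, h1⟩

lemma sum_commonNeighbor_range (hJ : ¬ ContainsJewel G) (hP : ¬ ContainsPyramid G)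
    (h : IsShortestOddHole G n f) {Y : Finset V} (hmaj : ∀ x ∈ Y, IsCMajor G f x)
    (hstab : ∀ x ∈ Y, ∀ y ∈ Y, ¬ G.Adj x y) (d : ℕ) : ∀ s : ℕ, d ≤ n →
    (∃ x ∈ Y, G.Adj x (f s)) → (∃ x ∈ Y, G.Adj x (f (s + d : ℕ))) →
    ∑ i ∈ range d, commonNeighbor G f Y (s + i : ℕ) = d := by
  induction d using Nat.strong_induction_on with
  | _ d ih =>
  intro s hdn hs ht
  rcases Nat.eq_zero_or_pos d with rfl | hd
  · simp
  obtain ⟨t, ht1, ht2, ht3, ht4⟩ := exists_first (P := fun k : ℕ => ∃ x ∈ Y, G.Adj x (f k))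
    (show s + 1 ≤ s + d by omega) le_rfl ht
  obtain ⟨e, rfl⟩ := Nat.exists_eq_add_of_le (show s ≤ t by omega)
  obtain ⟨c, rfl⟩ := Nat.exists_eq_add_of_le (show e ≤ d by omega)
  rw [sum_range_add, sum_commonNeighbor_consecutive hJ hP h hmaj hstab (by omega) (by omega)
    hs ht3 (fun i hi => ht4 i hi), Nat.cast_add]
  congr 1
  rw [← ih c (by omega) (s + e) (by omega) ht3 (by rwa [add_assoc])]
  simp only [add_assoc]

/-- The number of edges of the hole with a common neighbour in a nonempty stable set of major
vertices is odd. -/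
lemma sum_commonNeighbor [NeZero n] (hJ : ¬ ContainsJewel G) (hP : ¬ ContainsPyramid G)
    (h : IsShortestOddHole G n f) {Y : Finset V} (hmaj : ∀ x ∈ Y, IsCMajor G f x)
    (hstab : ∀ x ∈ Y, ∀ y ∈ Y, ¬ G.Adj x y) (hY : Y.Nonempty) :
    ∑ i, commonNeighbor G f Y i = 1 := by
  obtain ⟨x, hx⟩ := hY
  obtain ⟨s, -, hs, -⟩ := (hmaj x hx).exists_natCast h.1.1.1 0
  have key := sum_commonNeighbor_range hJ hP h hmaj hstab n s le_rfl ⟨x, hx, hs⟩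
    ⟨x, hx, by simpa using hs⟩
  rw [← Equiv.sum_comp (Equiv.addLeft (s : ZMod n)), sum_zmod_eq_sum_range]
  simpa [(ZMod.natCast_eq_one_iff_odd).2 h.1.2] using key

/-- Inclusion–exclusion modulo two for common neighbours. -/
lemma prod_commonNeighbor_singleton (X : Finset V) (i : ZMod n) :
    ∏ x ∈ X, commonNeighbor G f {x} i =
      ∑ Y ∈ X.powerset, (1 + commonNeighbor G f Y i) := by
  have hprod : ∀ Y : Finset V,
      1 + commonNeighbor G f Y i = ∏ x ∈ Y, (1 + commonNeighbor G f {x} i) := by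
    intro Y
    by_cases hex : ∃ z ∈ Y, G.Adj z (f i) ∧ G.Adj z (f (i + 1))
    · obtain ⟨z, hz, hzi⟩ := id hex
      rw [prod_eq_zero hz, commonNeighbor, if_pos hex]
      · rfl
      · rw [commonNeighbor, if_pos (by simpa using hzi)]
        rfl
    · rw [prod_eq_one, commonNeighbor, if_neg hex, add_zero]
      intro z hz
      rw [commonNeighbor, if_neg, add_zero]
      rintro ⟨w, hw, hwi⟩
      rw [mem_singleton] at hw
      exact hex ⟨w, hw ▸ hz, hwi⟩
  rw [sum_congr rfl fun Y _ => hprod Y, ← prod_one_add]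
  refine prod_congr rfl fun x _ => ?_
  rw [← add_assoc, CharTwo.add_self_eq_zero, zero_add]

end Counting

/-- In a graph with no jewel or pyramid, if `C` is a shortest odd hole
and `X` is a stable set of `C`-major vertices, then some vertex of `C` is `X`-complete. -/
theorem stable_major_has_complete_vertex {V : Type*} [Fintype V] (G : SimpleGraph V)
    (hJ : ¬ ContainsJewel G) (hP : ¬ ContainsPyramid G)
    (n : ℕ) (f : ZMod n → V) (hC : IsShortestOddHole G n f)
    (X : Set V) (hXmaj : ∀ x ∈ X, IsCMajor G f x)
    (hXstable : ∀ x ∈ X, ∀ y ∈ X, ¬ G.Adj x y) :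
    ∃ i : ZMod n, ∀ x ∈ X, G.Adj (f i) x := by
  classical
  have : NeZero n := ⟨by have := hC.1.1.1; omega⟩
  have hmaj : ∀ x ∈ X.toFinset, IsCMajor G f x := fun x hx => hXmaj x (Set.mem_toFinset.1 hx)
  have hsum : ∑ i, ∏ x ∈ X.toFinset, commonNeighbor G f {x} i = 1 := by
    simp only [prod_commonNeighbor_singleton]
    rw [Finset.sum_comm, Finset.sum_eq_single ∅]
    · simp [commonNeighbor, (ZMod.natCast_eq_one_iff_odd).2 hC.1.2]
    · intro Y hY hne
      rw [Finset.mem_powerset] at hY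
      rw [Finset.sum_add_distrib, sum_commonNeighbor hJ hP hC (fun x hx => hmaj x (hY hx))
        (fun x hx y hy => hXstable x (Set.mem_toFinset.1 (hY hx)) y (Set.mem_toFinset.1 (hY hy)))
        (Finset.nonempty_iff_ne_empty.2 hne)]
      simp [(ZMod.natCast_eq_one_iff_odd).2 hC.1.2, CharTwo.add_self_eq_zero]
    · simp
  obtain ⟨i, -, hi⟩ := Finset.exists_ne_zero_of_sum_ne_zero (hsum.trans_ne one_ne_zero)
  refine ⟨i, fun x hx => ?_⟩
  have hxi := Finset.prod_ne_zero_iff.1 hi x (Set.mem_toFinset.2 hx)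
  by_contra hadj
  refine hxi (if_neg ?_)
  rintro ⟨z, hz, h1, -⟩
  rw [Finset.mem_singleton] at hz
  exact hadj (hz ▸ h1.symm)
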